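/- (Four-point Wick theorem for non-symmetric products.) Let ψ₁, ψ₂, ψ₃, ψ₄ be fields ψᵢ = ψᵢ⁺ + ψᵢ⁻ in a ring A with four pairwise distinct times, and suppose every commutator [ψᵢ^ε, ψⱼ^δ] with ε, δ ∈ {+,−} lies in the center of A. Then T(1,2,3,4) = N(1,2,3,4) + D(1,2)N(3,4) + D(1,3)N(2,4) + D(1,4)N(2,3) + D(2,3)N(1,4) + D(2,4)N(1,3) + D(3,4)N(1,2) + D(1,2)D(3,4) + D(1,3)D(2,4) + D(1,4)D(2,3). -/

import Mathlib

/-- The full field: sum of its `+` and `-` parts. -/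
def psi {ι A : Type*} [Ring A] (psiP psiM : ι → A) (i : ι) : A := psiP i + psiM i

/-- Two-point normal ordered product `N(i,j)`. -/
def N2 {ι A : Type*} [Ring A] (psiP psiM : ι → A) (i j : ι) : A :=
  psiP i * psiP j + psiM i * psiP j + psiM j * psiP i + psiM i * psiM j

/-- Two-point time-ordered product `T(i,j)` (for distinct times). -/
noncomputable def T2 {ι A : Type*} [Ring A] (psiP psiM : ι → A) (t : ι → ℝ) (i j : ι) : A :=
  if t i > t j then psi psiP psiM i * psi psiP psiM j
  else psi psiP psiM j * psi psiP psiM i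

/-- The contraction `D(i,j) := T(i,j) - N(i,j)`. -/
noncomputable def D2 {ι A : Type*} [Ring A] (psiP psiM : ι → A) (t : ι → ℝ) (i j : ι) : A :=
  T2 psiP psiM t i j - N2 psiP psiM i j

/-- Multi-point normal ordered product of a list of field indices:
`N(i₁,…,iₖ) = Σ_{S ⊆ {1,…,k}} (∏_{j∈S, j increasing} ψ_{i_j}⁻)·(∏_{j∉S, j increasing} ψ_{i_j}⁺)`. -/
def Nord {ι A : Type*} [Ring A] (psiP psiM : ι → A) (L : List ι) : A :=
  ∑ S : Finset (Fin L.length),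
    (((List.finRange L.length).filter (fun j => decide (j ∈ S))).map
        (fun j => psiM (L.get j))).prod *
    (((List.finRange L.length).filter (fun j => decide (j ∉ S))).map
        (fun j => psiP (L.get j))).prod

/-- Multi-point time ordered product: the fields multiplied in order of decreasing time. -/
noncomputable def Tlist {ι A : Type*} [Ring A] (psiP psiM : ι → A) (t : ι → ℝ)
    (L : List ι) : A :=
  ((L.insertionSort (fun i j => t j ≤ t i)).map (psi psiP psiM)).prod

/-- The four-point normal ordered product, written out. -/
theorem Nord_four {ι A : Type*} [Ring A] (p m : ι → A) (a b c e : ι) :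
    Nord p m [a, b, c, e] =
      p a * p b * p c * p e + m a * p b * p c * p e + m b * p a * p c * p e
      + m c * p a * p b * p e + m e * p a * p b * p c
      + m a * m b * p c * p e + m a * m c * p b * p e + m a * m e * p b * p c
      + m b * m c * p a * p e + m b * m e * p a * p c + m c * m e * p a * p b
      + m a * m b * m c * p e + m a * m b * m e * p c + m a * m c * m e * p b
      + m b * m c * m e * p a + m a * m b * m c * m e := by
  have key : (Finset.univ : Finset (Finset (Fin 4))) =
      {∅, {0}, {1}, {2}, {3}, {0, 1}, {0, 2}, {0, 3}, {1, 2}, {1, 3}, {2, 3},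
        {0, 1, 2}, {0, 1, 3}, {0, 2, 3}, {1, 2, 3}, {0, 1, 2, 3}} := by decide
  have hf : List.finRange 4 = [0, 1, 2, 3] := by decide
  change ∑ S : Finset (Fin 4),
    (((List.finRange 4).filter (fun j => decide (j ∈ S))).map
        (fun j => m ([a, b, c, e].get j))).prod *
    (((List.finRange 4).filter (fun j => decide (j ∉ S))).map
        (fun j => p ([a, b, c, e].get j))).prod = _
  rw [key, hf]
  repeat rw [Finset.sum_insert (by decide)]
  rw [Finset.sum_singleton]
  simp [mul_assoc, add_assoc]

theorem Nord_two {ι A : Type*} [Ring A] (p m : ι → A) (a b : ι) :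
    Nord p m [a, b] = N2 p m a b := by
  have key : (Finset.univ : Finset (Finset (Fin 2))) = {∅, {0}, {1}, {0, 1}} := by decide
  have hf : List.finRange 2 = [0, 1] := by decide
  change ∑ S : Finset (Fin 2),
    (((List.finRange 2).filter (fun j => decide (j ∈ S))).map
        (fun j => m ([a, b].get j))).prod *
    (((List.finRange 2).filter (fun j => decide (j ∉ S))).map
        (fun j => p ([a, b].get j))).prod = _
  rw [key, hf]
  repeat rw [Finset.sum_insert (by decide)]
  rw [Finset.sum_singleton]
  simp [N2, add_assoc]

section Wick

variable {ι R A : Type*} [CommRing R] [Ring A] [Algebra R A]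

/-- The four-point Wick expansion with scalar contractions `d`. -/
def wickFour (p m : ι → A) (d : ι → ι → R) (a b c e : ι) : A :=
  Nord p m [a, b, c, e] + d a b • N2 p m c e + d a c • N2 p m b e + d a e • N2 p m b c
    + d b c • N2 p m a e + d b e • N2 p m a c + d c e • N2 p m a b
    + ((d a b * d c e + d a c * d b e + d a e * d b c) • 1 : A)

theorem mul_mul_of_mul_eq {x y : A} {z : R} (h : x * y = y * x + z • 1) (w : A) :
    x * (y * w) = y * (x * w) + z • w := by
  rw [← mul_assoc, h, add_mul, smul_mul_assoc, one_mul, mul_assoc]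

variable {p m : ι → A} {d : ι → ι → R} {a b c e : ι} {x y : R}

theorem wickFour_swap_first (hp : p a * p b = p b * p a + x • 1)
    (hm : m a * m b = m b * m a + y • 1) (hd : d b a = d a b + (x + y)) :
    wickFour p m d a b c e = wickFour p m d b a c e := by
  simp only [wickFour, Nord_four, N2, hd, mul_assoc]
  simp only [hp, hm, mul_mul_of_mul_eq hp, mul_mul_of_mul_eq hm, mul_add, mul_smul_comm, mul_one]
  module

theorem wickFour_swap_middle (hp : p b * p c = p c * p b + x • 1)
    (hm : m b * m c = m c * m b + y • 1) (hd : d c b = d b c + (x + y)) :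
    wickFour p m d a b c e = wickFour p m d a c b e := by
  simp only [wickFour, Nord_four, N2, hd, mul_assoc]
  simp only [hp, hm, mul_mul_of_mul_eq hp, mul_mul_of_mul_eq hm, mul_add, mul_smul_comm, mul_one]
  module

theorem wickFour_swap_last (hp : p c * p e = p e * p c + x • 1)
    (hm : m c * m e = m e * m c + y • 1) (hd : d e c = d c e + (x + y)) :
    wickFour p m d a b c e = wickFour p m d a b e c := by
  simp only [wickFour, Nord_four, N2, hd, mul_assoc]
  simp only [hp, hm, mul_mul_of_mul_eq hm, mul_add, mul_smul_comm, mul_one]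
  module

/-- The Wick expansion of an ordinary product, with contractions `[ψᵢ⁺, ψⱼ⁻]`. -/
theorem psi_mul_psi_mul_psi_mul_psi
    (hab : p a * m b = m b * p a + d a b • 1) (hac : p a * m c = m c * p a + d a c • 1)
    (hae : p a * m e = m e * p a + d a e • 1) (hbc : p b * m c = m c * p b + d b c • 1)
    (hbe : p b * m e = m e * p b + d b e • 1) (hce : p c * m e = m e * p c + d c e • 1) :
    psi p m a * (psi p m b * (psi p m c * psi p m e)) = wickFour p m d a b c e := by
  simp only [psi, wickFour, Nord_four, N2, mul_assoc, mul_add, add_mul,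
    hab, hac, hae, hbe, hce, mul_mul_of_mul_eq hab, mul_mul_of_mul_eq hac,
    mul_mul_of_mul_eq hae, mul_mul_of_mul_eq hbc, mul_mul_of_mul_eq hbe,
    mul_smul_comm, mul_one, smul_add, smul_smul]
  module

end Wick

section CentralCommutators

variable {ι A : Type*} [Ring A] {p m : ι → A} {t : ι → ℝ}

theorem D2_of_lt {i j : ι} (h : t j < t i) :
    D2 p m t i j = p i * m j - m j * p i := by
  simp only [D2, T2, N2, psi, gt_iff_lt, if_pos h]
  noncomm_ring

theorem D2_swap_of_ne {i j : ι} (h : t i ≠ t j) :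
    D2 p m t j i = D2 p m t i j + (p i * p j - p j * p i + (m i * m j - m j * m i)) := by
  have hT : T2 p m t j i = T2 p m t i j := by
    rcases lt_or_gt_of_ne h with h | h
    · simp [T2, h, h.le.not_gt]
    · simp [T2, h, h.le.not_gt]
  rw [D2, D2, hT, N2, N2]
  abel

theorem D2_mem_center
    (hpp : ∀ i j, p i * p j - p j * p i ∈ Set.center A)
    (hpm : ∀ i j, p i * m j - m j * p i ∈ Set.center A)
    (hmm : ∀ i j, m i * m j - m j * m i ∈ Set.center A) (i j : ι) :
    D2 p m t i j ∈ Subring.center A := by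
  by_cases h : t j < t i
  · rw [D2_of_lt h]
    exact hpm i j
  · have : D2 p m t i j =
        (p j * p i - p i * p j) + (p j * m i - m i * p j) + (m j * m i - m i * m j) := by
      simp only [D2, T2, N2, psi, gt_iff_lt, if_neg h]
      noncomm_ring
    rw [this]
    exact add_mem (add_mem (hpp j i) (hpm j i)) (hmm j i)

end CentralCommutators

theorem Tlist_ofFn {A : Type*} [Ring A] (p m : Fin 4 → A) {t : Fin 4 → ℝ}
    (ht : Function.Injective t) {σ : Equiv.Perm (Fin 4)} (hσ : StrictAnti (t ∘ σ)) :
    Tlist p m t [0, 1, 2, 3] =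
      psi p m (σ 0) * (psi p m (σ 1) * (psi p m (σ 2) * psi p m (σ 3))) := by
  have : Std.Total (fun i j : Fin 4 => t j ≤ t i) := ⟨fun i j => le_total _ _⟩
  have : IsTrans (Fin 4) (fun i j => t j ≤ t i) := ⟨fun i j k h h' => h'.trans h⟩
  have hsort : [0, 1, 2, 3].insertionSort (fun i j => t j ≤ t i) = List.ofFn σ := by
    refine List.Perm.eq_of_pairwise (le := fun i j => t j ≤ t i)
      (fun i j _ _ h h' => ht (le_antisymm h' h))
      (List.pairwise_insertionSort _ _) ?_ ?_
    · exact List.pairwise_ofFn.2 fun i j hij => (hσ hij).le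
    · exact (List.perm_insertionSort _ _).trans (Equiv.Perm.ofFn_comp_perm σ id).symm
  rw [Tlist, hsort]
  simp [List.ofFn_succ]

/-- **Four-point Wick theorem for non-symmetric products.**  For four fields with pairwise
distinct times whose part-commutators are all central,
`T(1,2,3,4) = N(1,2,3,4) + Σ D·N + Σ D·D` in the usual Wick pattern. -/
theorem stmt_13 {A : Type*} [Ring A] (psiP psiM : Fin 4 → A) (t : Fin 4 → ℝ)
    (ht : Function.Injective t)
    (hpp : ∀ i j : Fin 4, psiP i * psiP j - psiP j * psiP i ∈ Set.center A)
    (hpm : ∀ i j : Fin 4, psiP i * psiM j - psiM j * psiP i ∈ Set.center A)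
    (hmp : ∀ i j : Fin 4, psiM i * psiP j - psiP j * psiM i ∈ Set.center A)
    (hmm : ∀ i j : Fin 4, psiM i * psiM j - psiM j * psiM i ∈ Set.center A) :
    Tlist psiP psiM t [0, 1, 2, 3] =
      Nord psiP psiM [0, 1, 2, 3]
      + D2 psiP psiM t 0 1 * Nord psiP psiM [2, 3]
      + D2 psiP psiM t 0 2 * Nord psiP psiM [1, 3]
      + D2 psiP psiM t 0 3 * Nord psiP psiM [1, 2]
      + D2 psiP psiM t 1 2 * Nord psiP psiM [0, 3]
      + D2 psiP psiM t 1 3 * Nord psiP psiM [0, 2]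
      + D2 psiP psiM t 2 3 * Nord psiP psiM [0, 1]
      + D2 psiP psiM t 0 1 * D2 psiP psiM t 2 3
      + D2 psiP psiM t 0 2 * D2 psiP psiM t 1 3
      + D2 psiP psiM t 0 3 * D2 psiP psiM t 1 2 := by
  let R := Subring.center A
  let d : Fin 4 → Fin 4 → R := fun i j => ⟨D2 psiP psiM t i j, D2_mem_center hpp hpm hmm i j⟩
  have hp (i j : Fin 4) : psiP i * psiP j = psiP j * psiP i + (⟨_, hpp i j⟩ : R) • 1 := by
    simp [R, Subring.smul_def]
  have hm (i j : Fin 4) : psiM i * psiM j = psiM j * psiM i + (⟨_, hmm i j⟩ : R) • 1 := by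
    simp [R, Subring.smul_def]
  have hd {i j : Fin 4} (h : i ≠ j) : d j i = d i j + (⟨_, hpp i j⟩ + ⟨_, hmm i j⟩) :=
    Subtype.ext (D2_swap_of_ne (ht.ne h))
  have hperm (σ : Equiv.Perm (Fin 4)) :
      wickFour psiP psiM d (σ 0) (σ 1) (σ 2) (σ 3) = wickFour psiP psiM d 0 1 2 3 := by
    have hσ : σ ∈ Submonoid.closure
        (Set.range fun i : Fin 3 => Equiv.swap i.castSucc i.succ) := by
      rw [Equiv.Perm.mclosure_swap_castSucc_succ]
      trivial
    induction hσ using Submonoid.closure_induction_right with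
    | one => rfl
    | mul_right τ _ s hs ih =>
      obtain ⟨i, rfl⟩ := hs
      rw [← ih]
      fin_cases i
      · exact (wickFour_swap_first (hp _ _) (hm _ _) (hd (τ.injective.ne (by decide)))).symm
      · exact (wickFour_swap_middle (hp _ _) (hm _ _) (hd (τ.injective.ne (by decide)))).symm
      · exact (wickFour_swap_last (hp _ _) (hm _ _) (hd (τ.injective.ne (by decide)))).symm
  obtain ⟨σ, hσ⟩ : ∃ σ : Equiv.Perm (Fin 4), StrictAnti (t ∘ σ) := by
    refine ⟨Tuple.sort fun i => -t i, Antitone.strictAnti_of_injective ?_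
      (ht.comp (Equiv.injective _))⟩
    exact fun i j h => neg_le_neg_iff.1 (Tuple.monotone_sort (fun i => -t i) h)
  have hc {i j : Fin 4} (h : i < j) :
      psiP (σ i) * psiM (σ j) = psiM (σ j) * psiP (σ i) + d (σ i) (σ j) • 1 := by
    have hlt : t (σ j) < t (σ i) := hσ h
    simp [d, Subring.smul_def, D2_of_lt hlt]
  rw [Tlist_ofFn psiP psiM ht hσ, psi_mul_psi_mul_psi_mul_psi (d := d) (hc (by decide))
    (hc (by decide)) (hc (by decide)) (hc (by decide)) (hc (by decide)) (hc (by decide)), hperm]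
  simp [wickFour, d, Subring.smul_def, Nord_two, add_assoc]
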